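/- Fix input size p ≥ 3, a measurable space Z = ℝ^{p×p} × {0,1} with probability measure D, and N ≥ 1. Let f : ℝⁿ → ℝ^{3×3} be a generator function such that some choice of od ∈ ℕ and parameters p¹, …, p^{od} makes the first-layer convolution map I ↦ (C_{f(p¹)}(I), …, C_{f(p^{od})}(I)) injective. For a network F let ℓ_F(I, y) = (F̃(I) − y)² ∈ [0,1] be its loss function, and let L be the (countable, e.g. rational-weight) class of loss functions of common CNNs with a fixed architecture. Fix δ ∈ (0,1). Then with probability at least 1 − δ over S = ((I₁,y₁), …, (I_N,y_N)) drawn i.i.d. from D, for every common CNN F in the class and every ε > 0, there exist d* ∈ ℕ and a well-defined GO-CNN G with generator f and first-fully-connected-layer width d₁ ≥ d* such that E_{(I,y)∼D}[ℓ_G(I,y)] ≤ Ê_S[F] + 2·Ř_S(L) + √(log(1/δ)/(2N)) + ε. (Theorem 2) -/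

import Mathlib

open MeasureTheory

/-- Valid 2D discrete convolution of an input `I : ℝ^{p×q}` with a kernel `k : ℝ^{m×m}`. -/
noncomputable def conv2d (p q m : ℕ) (hp : m ≤ p) (hq : m ≤ q)
    (k : Matrix (Fin m) (Fin m) ℝ) (I : Matrix (Fin p) (Fin q) ℝ) :
    Matrix (Fin (p - m + 1)) (Fin (q - m + 1)) ℝ :=
  fun i j => ∑ s : Fin m, ∑ t : Fin m,
    I ⟨i.val + s.val, by have h1 := i.isLt; have h2 := s.isLt; omega⟩
      ⟨j.val + t.val, by have h1 := j.isLt; have h2 := t.isLt; omega⟩ * k s t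

/-- The sigmoid activation `σ(t) = 1 / (1 + e^{-t})`. -/
noncomputable def sigmoid (t : ℝ) : ℝ := 1 / (1 + Real.exp (-t))

/-- Pre-activation output of a CNN with one convolutional layer (with `d₀` kernels of
size 3×3) followed by two fully-connected layers with sigmoid activations:
`F(x) = a₂ ⬝ σ(A₁ ⬝ σ(vec(C(x)) + b₀) + b₁) + b₂`. -/
noncomputable def cnnOut {p d₀ d₁ : ℕ} (hp : 3 ≤ p)
    (ker : Fin d₀ → Matrix (Fin 3) (Fin 3) ℝ)
    (b₀ : Fin d₀ × Fin (p - 3 + 1) × Fin (p - 3 + 1) → ℝ)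
    (A₁ : Matrix (Fin d₁) (Fin d₀ × Fin (p - 3 + 1) × Fin (p - 3 + 1)) ℝ)
    (b₁ : Fin d₁ → ℝ) (a₂ : Fin d₁ → ℝ) (b₂ : ℝ)
    (x : Matrix (Fin p) (Fin p) ℝ) : ℝ :=
  let feat : Fin d₀ × Fin (p - 3 + 1) × Fin (p - 3 + 1) → ℝ :=
    fun q => conv2d p p 3 hp hp (ker q.1) x q.2.1 q.2.2
  let h₀ : Fin d₀ × Fin (p - 3 + 1) × Fin (p - 3 + 1) → ℝ :=
    fun q => sigmoid (feat q + b₀ q)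
  let h₁ : Fin d₁ → ℝ := fun i => sigmoid (A₁.mulVec h₀ i + b₁ i)
  (∑ i : Fin d₁, a₂ i * h₁ i) + b₂

/-- Loss function `ℓ_F(I, y) = (F̃(I) - y)²` of a network on a labelled example,
with labels in `{0, 1}` encoded by `Bool`. -/
noncomputable def cnnLoss {p d₀ d₁ : ℕ} (hp : 3 ≤ p)
    (ker : Fin d₀ → Matrix (Fin 3) (Fin 3) ℝ)
    (b₀ : Fin d₀ × Fin (p - 3 + 1) × Fin (p - 3 + 1) → ℝ)
    (A₁ : Matrix (Fin d₁) (Fin d₀ × Fin (p - 3 + 1) × Fin (p - 3 + 1)) ℝ)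
    (b₁ : Fin d₁ → ℝ) (a₂ : Fin d₁ → ℝ) (b₂ : ℝ)
    (z : Matrix (Fin p) (Fin p) ℝ × Bool) : ℝ :=
  (sigmoid (cnnOut hp ker b₀ A₁ b₁ a₂ b₂ z.1) - (if z.2 then (1 : ℝ) else 0)) ^ 2

/-- Empirical Rademacher complexity of a class `H` of real-valued functions on `Z`
with respect to the sample `S = (z₁, …, z_N)`. -/
noncomputable def empRad {Z : Type*} {N : ℕ} (S : Fin N → Z) (H : Set (Z → ℝ)) : ℝ :=
  (2 ^ N : ℝ)⁻¹ * ∑ ε : Fin N → Bool,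
    sSup ((fun h : Z → ℝ =>
      (N : ℝ)⁻¹ * ∑ i : Fin N, (if ε i then (1 : ℝ) else -1) * h (S i)) '' H)

/-- A matrix of reals carries the product measurable structure. -/
instance matrixMeasurableSpace {p q : ℕ} :
    MeasurableSpace (Matrix (Fin p) (Fin q) ℝ) := by
  unfold Matrix; infer_instance

noncomputable def polyW (s c : ℝ) : ℝ := c + (1 - 2 * c) * (7/20 * s - 3/25 * s^2)

noncomputable def polyLHS (s c : ℝ) : ℝ :=
  (1 + (2*s*c^2 - s/4) + (2*s*c^2 - s/4)^2/2 + (2*s*c^2 - s/4)^3/6) *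
    (1 + s/4 + s^2/4 - 2*s*(polyW s c)^2)

noncomputable def bern8 (a0 a1 a2 a3 a4 a5 a6 a7 a8 d : ℝ) : ℝ :=
  a0*(1-d)^8 + a1*(d*(1-d)^7) + a2*(d^2*(1-d)^6) + a3*(d^3*(1-d)^5) + a4*(d^4*(1-d)^4) +
    a5*(d^5*(1-d)^3) + a6*(d^6*(1-d)^2) + a7*(d^7*(1-d)) + a8*d^8

lemma bern8_nonneg (a0 a1 a2 a3 a4 a5 a6 a7 a8 d : ℝ) (hd0 : 0 ≤ d) (hd1 : d ≤ 1)
    (h0 : 0 ≤ a0) (h1 : 0 ≤ a1) (h2 : 0 ≤ a2) (h3 : 0 ≤ a3) (h4 : 0 ≤ a4) (h5 : 0 ≤ a5)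
    (h6 : 0 ≤ a6) (h7 : 0 ≤ a7) (h8 : 0 ≤ a8) : 0 ≤ bern8 a0 a1 a2 a3 a4 a5 a6 a7 a8 d := by
  have h : 0 ≤ 1 - d := by linarith
  unfold bern8
  positivity

set_option maxHeartbeats 4000000 in
lemma poly_box_one (s d : ℝ) (hs0 : 0 ≤ s) (hs1 : s ≤ 1) (hd0 : 0 ≤ d) (hd1 : d ≤ 1) :
    1 ≤ polyLHS s (d/2) := by
  have h1 : 0 ≤ 1 - s := by linarith
  have q0 := bern8_nonneg (7/32) (21/20) (41/20) (5/2) (49/16) (15/4) (61/20) (13/10) (7/32) d hd0 hd1 (by norm_num) (by norm_num) (by norm_num)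
    (by norm_num) (by norm_num) (by norm_num) (by norm_num) (by norm_num) (by norm_num)
  have q1 := bern8_nonneg (4849/4800) (359/75) (23051/2400) (3199/240) (2287/120) (14443/600) (46273/2400) (9763/1200) (263/192) d hd0 hd1 (by norm_num) (by norm_num) (by norm_num)
    (by norm_num) (by norm_num) (by norm_num) (by norm_num) (by norm_num) (by norm_num)
  have q2 := bern8_nonneg (128397/64000) (38137/4000) (38923/1920) (6493/200) (328811/6400) (778391/12000) (813553/16000) (8489/400) (5491/1536) d hd0 hd1 (by norm_num) (by norm_num) (by norm_num)
    (by norm_num) (by norm_num) (by norm_num) (by norm_num) (by norm_num) (by norm_num)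
  have q3 := bern8_nonneg (709959/320000) (5185781/480000) (1201111/48000) (291479/6400) (7265447/96000) (44942411/480000) (5726741/80000) (567067/19200) (7645/1536) d hd0 hd1 (by norm_num) (by norm_num) (by norm_num)
    (by norm_num) (by norm_num) (by norm_num) (by norm_num) (by norm_num) (by norm_num)
  have q4 := bern8_nonneg (2788931/1920000) (7104193/960000) (36257737/1920000) (9055601/240000) (121771867/1920000) (73099957/960000) (108899023/1920000) (444061/19200) (5989/1536) d hd0 hd1 (by norm_num) (by norm_num) (by norm_num)
    (by norm_num) (by norm_num) (by norm_num) (by norm_num) (by norm_num) (by norm_num)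
  have q5 := bern8_nonneg (128209/240000) (230793/80000) (7729793/960000) (8181541/480000) (9087719/320000) (1980361/60000) (23010623/960000) (61843/6400) (2503/1536) d hd0 hd1 (by norm_num) (by norm_num) (by norm_num)
    (by norm_num) (by norm_num) (by norm_num) (by norm_num) (by norm_num) (by norm_num)
  have q6 := bern8_nonneg (164329/1920000) (471637/960000) (565877/384000) (4831/1500) (10130791/1920000) (5708593/960000) (8099903/1920000) (32311/19200) (109/384) d hd0 hd1 (by norm_num) (by norm_num) (by norm_num)
    (by norm_num) (by norm_num) (by norm_num) (by norm_num) (by norm_num) (by norm_num)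
  have e : polyLHS s (d/2) = 1 + s^2 * (
      s^0*(1-s)^6 * bern8 (7/32) (21/20) (41/20) (5/2) (49/16) (15/4) (61/20) (13/10) (7/32) d +
      s^1*(1-s)^5 * bern8 (4849/4800) (359/75) (23051/2400) (3199/240) (2287/120) (14443/600) (46273/2400) (9763/1200) (263/192) d +
      s^2*(1-s)^4 * bern8 (128397/64000) (38137/4000) (38923/1920) (6493/200) (328811/6400) (778391/12000) (813553/16000) (8489/400) (5491/1536) d +
      s^3*(1-s)^3 * bern8 (709959/320000) (5185781/480000) (1201111/48000) (291479/6400) (7265447/96000) (44942411/480000) (5726741/80000) (567067/19200) (7645/1536) d +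
      s^4*(1-s)^2 * bern8 (2788931/1920000) (7104193/960000) (36257737/1920000) (9055601/240000) (121771867/1920000) (73099957/960000) (108899023/1920000) (444061/19200) (5989/1536) d +
      s^5*(1-s)^1 * bern8 (128209/240000) (230793/80000) (7729793/960000) (8181541/480000) (9087719/320000) (1980361/60000) (23010623/960000) (61843/6400) (2503/1536) d +
      s^6*(1-s)^0 * bern8 (164329/1920000) (471637/960000) (565877/384000) (4831/1500) (10130791/1920000) (5708593/960000) (8099903/1920000) (32311/19200) (109/384) d) := by
    unfold polyLHS polyW bern8
    ring
  rw [e]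
  apply le_add_of_nonneg_right
  positivity

set_option maxHeartbeats 4000000 in
lemma poly_box_two (s d : ℝ) (hs0 : 0 ≤ s) (hs1 : s ≤ 1) (hd0 : 0 ≤ d) (hd1 : d ≤ 1) :
    1 ≤ polyLHS s ((1+d)/2) := by
  have h1 : 0 ≤ 1 - s := by linarith
  have q0 := bern8_nonneg (7/32) (11/5) (187/20) (433/20) (473/16) 24 (219/20) (47/20) (19/160) d hd0 hd1 (by norm_num) (by norm_num) (by norm_num)
    (by norm_num) (by norm_num) (by norm_num) (by norm_num) (by norm_num) (by norm_num)
  have q1 := bern8_nonneg (263/192) (16537/1200) (141109/2400) (2751/20) (1913/10) (12779/80) (182359/2400) (10481/600) (209/192) d hd0 hd1 (by norm_num) (by norm_num) (by norm_num)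
    (by norm_num) (by norm_num) (by norm_num) (by norm_num) (by norm_num) (by norm_num)
  have q2 := bern8_nonneg (5491/1536) (86341/2400) (7397639/48000) (728301/2000) (3296611/6400) (352807/800) (2085043/9600) (157139/3000) (676631/192000) d hd0 hd1 (by norm_num) (by norm_num) (by norm_num)
    (by norm_num) (by norm_num) (by norm_num) (by norm_num) (by norm_num) (by norm_num)
  have q3 := bern8_nonneg (7645/1536) (961933/19200) (8621833/40000) (82280747/160000) (23654059/32000) (829317/1280) (1978597/6000) (40061431/480000) (1988779/320000) d hd0 hd1 (by norm_num) (by norm_num) (by norm_num)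
    (by norm_num) (by norm_num) (by norm_num) (by norm_num) (by norm_num) (by norm_num)
  have q4 := bern8_nonneg (5989/1536) (753739/19200) (325673623/1920000) (130719327/320000) (381535369/640000) (10682513/20000) (538346897/1920000) (71395553/960000) (11833939/1920000) d hd0 hd1 (by norm_num) (by norm_num) (by norm_num)
    (by norm_num) (by norm_num) (by norm_num) (by norm_num) (by norm_num) (by norm_num)
  have q5 := bern8_nonneg (2503/1536) (315071/19200) (22783441/320000) (553533/3200) (81912259/320000) (37426469/160000) (121140109/960000) (261419/7500) (63089/20000) d hd0 hd1 (by norm_num) (by norm_num) (by norm_num)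
    (by norm_num) (by norm_num) (by norm_num) (by norm_num) (by norm_num) (by norm_num)
  have q6 := bern8_nonneg (109/384) (54889/19200) (23904503/1920000) (78039/2560) (29215037/640000) (3390987/80000) (44808929/1920000) (6354557/960000) (1201577/1920000) d hd0 hd1 (by norm_num) (by norm_num) (by norm_num)
    (by norm_num) (by norm_num) (by norm_num) (by norm_num) (by norm_num) (by norm_num)
  have e : polyLHS s ((1+d)/2) = 1 + s^2 * (
      s^0*(1-s)^6 * bern8 (7/32) (11/5) (187/20) (433/20) (473/16) 24 (219/20) (47/20) (19/160) d +
      s^1*(1-s)^5 * bern8 (263/192) (16537/1200) (141109/2400) (2751/20) (1913/10) (12779/80) (182359/2400) (10481/600) (209/192) d +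
      s^2*(1-s)^4 * bern8 (5491/1536) (86341/2400) (7397639/48000) (728301/2000) (3296611/6400) (352807/800) (2085043/9600) (157139/3000) (676631/192000) d +
      s^3*(1-s)^3 * bern8 (7645/1536) (961933/19200) (8621833/40000) (82280747/160000) (23654059/32000) (829317/1280) (1978597/6000) (40061431/480000) (1988779/320000) d +
      s^4*(1-s)^2 * bern8 (5989/1536) (753739/19200) (325673623/1920000) (130719327/320000) (381535369/640000) (10682513/20000) (538346897/1920000) (71395553/960000) (11833939/1920000) d +
      s^5*(1-s)^1 * bern8 (2503/1536) (315071/19200) (22783441/320000) (553533/3200) (81912259/320000) (37426469/160000) (121140109/960000) (261419/7500) (63089/20000) d +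
      s^6*(1-s)^0 * bern8 (109/384) (54889/19200) (23904503/1920000) (78039/2560) (29215037/640000) (3390987/80000) (44808929/1920000) (6354557/960000) (1201577/1920000) d) := by
    unfold polyLHS polyW bern8
    ring
  rw [e]
  apply le_add_of_nonneg_right
  positivity


lemma exp_cubic (x : ℝ) (hx : -(1/4) ≤ x) : 1 + x + x^2/2 + x^3/6 ≤ Real.exp x := by
  rcases le_total 0 x with h | h
  · have := Real.sum_le_exp_of_nonneg h 4
    simp [Finset.sum_range_succ, Nat.factorial] at this
    linarith
  · have habs : |x| ≤ 1 := by rw [abs_le]; constructor <;> linarith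
    have := Real.exp_bound habs (n := 5) (by norm_num)
    simp [Finset.sum_range_succ, Nat.factorial] at this
    have h2 := (abs_le.1 this).1
    rw [abs_of_nonpos h] at h2
    have h4 : 0 ≤ x^4 := by positivity
    have : 0 ≤ x^4 * (x + 1/4) := mul_nonneg h4 (by linarith)
    nlinarith

lemma poly_all (s c : ℝ) (hs0 : 0 ≤ s) (hs1 : s ≤ 1) (hc0 : 0 ≤ c) (hc1 : c ≤ 1) :
    1 ≤ polyLHS s c := by
  rcases le_total c (1/2) with h | h
  · have := poly_box_one s (2*c) hs0 hs1 (by linarith) (by linarith)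
    rwa [show 2*c/2 = c by ring] at this
  · have := poly_box_two s (2*c-1) hs0 hs1 (by linarith) (by linarith)
    rwa [show (1+(2*c-1))/2 = c by ring] at this

lemma exp_point (s c : ℝ) (hs0 : 0 ≤ s) (hs1 : s ≤ 1) (hc0 : 0 ≤ c) (hc1 : c ≤ 1) :
    Real.exp (-(2*s) * c^2) ≤
      Real.exp (-(s/4)) * (1 + s/4 + s^2/4 - 2*s*(polyW s c)^2) := by
  have h := poly_all s c hs0 hs1 hc0 hc1
  unfold polyLHS at h
  set x := 2*s*c^2 - s/4 with hx
  have hxl : -(1/4) ≤ x := by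
    have : 0 ≤ 2*s*c^2 := by positivity
    linarith
  have hc := exp_cubic x hxl
  set R := 1 + s/4 + s^2/4 - 2*s*(polyW s c)^2 with hR
  have hT : 0 < 1 + x + x^2/2 + x^3/6 := by nlinarith [sq_nonneg (x+1), sq_nonneg x, mul_nonneg (sq_nonneg x) (by linarith : (0:ℝ) ≤ x + 1/4)]
  have hRpos : 0 < R := by
    by_contra hn
    push Not at hn
    nlinarith
  have h1 : 1 ≤ Real.exp x * R := h.trans (mul_le_mul_of_nonneg_right hc hRpos.le)
  have e1 : Real.exp (-(s/4)) = Real.exp (-(2*s)*c^2) * Real.exp x := by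
    rw [← Real.exp_add]; congr 1; rw [hx]; ring
  rw [e1, mul_assoc]
  nlinarith [Real.exp_pos (-(2*s)*c^2)]

lemma polyW_symm (s c : ℝ) : polyW s (1 - c) = 1 - polyW s c := by unfold polyW; ring

lemma polyW_mem (s c : ℝ) (hs0 : 0 < s) (hs1 : s ≤ 1) (hc0 : 0 ≤ c) (hc1 : c ≤ 1) :
    0 < polyW s c ∧ polyW s c < 1 := by
  unfold polyW
  have hv : 0 < 7/20 * s - 3/25 * s^2 := by nlinarith
  have hv1 : 7/20 * s - 3/25 * s^2 < 1/2 := by nlinarith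
  set v := 7/20 * s - 3/25 * s^2
  constructor <;> nlinarith

/-- mgf bound -/
lemma mgf_bound {Z : Type*} [MeasurableSpace Z] (D : Measure Z) [IsProbabilityMeasure D]
    (c : Z → ℝ) (y : Z → Bool) (hc : Measurable c) (hy : Measurable y)
    (hc0 : ∀ z, 0 ≤ c z) (hc1 : ∀ z, c z ≤ 1) (s m : ℝ) (hs0 : 0 < s) (hs1 : s ≤ 1)
    (hm : m ≤ ∫ z, (polyW s (c z) - (if y z then (1:ℝ) else 0))^2 ∂D) :
    ∫ z, Real.exp (-(2*s) * (c z - (if y z then (1:ℝ) else 0))^2) ∂D ≤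
      Real.exp (s^2/4 - 2*s*m) := by
  have hyr : Measurable fun z => (if y z then (1:ℝ) else 0) := by
    apply Measurable.ite _ measurable_const measurable_const
    exact hy (measurableSet_singleton true)
  have hw : Measurable fun z => polyW s (c z) := by unfold polyW; fun_prop
  have hint1 : Integrable (fun z => (polyW s (c z) - (if y z then (1:ℝ) else 0))^2) D := by
    refine Integrable.of_bound (C := 1) (by fun_prop) (ae_of_all _ fun z => ?_)
    have := polyW_mem s (c z) hs0 hs1 (hc0 z) (hc1 z)
    rw [Real.norm_eq_abs, abs_of_nonneg (sq_nonneg _)]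
    split_ifs <;> nlinarith
  have hint2 : Integrable (fun z => Real.exp (-(2*s) * (c z - (if y z then (1:ℝ) else 0))^2)) D := by
    refine Integrable.of_bound (C := 1) (by fun_prop) (ae_of_all _ fun z => ?_)
    rw [Real.norm_eq_abs, abs_of_nonneg (Real.exp_pos _).le]
    rw [Real.exp_le_one_iff]
    have := sq_nonneg (c z - (if y z then (1:ℝ) else 0))
    nlinarith
  calc _ ≤ ∫ z, Real.exp (-(s/4)) * (1 + s/4 + s^2/4 - 2*s*(polyW s (c z) - (if y z then (1:ℝ) else 0))^2) ∂D := by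
        apply integral_mono hint2
        · exact (((integrable_const _).sub (hint1.const_mul _))).const_mul _
        · intro z
          dsimp only
          by_cases h : y z
          · have := exp_point s (1 - c z) hs0.le hs1 (by linarith [hc1 z]) (by linarith [hc0 z])
            rw [polyW_symm] at this
            simp only [h, if_true]
            rw [show (c z - 1)^2 = (1 - c z)^2 by ring, show (polyW s (c z) - 1)^2 = (1 - polyW s (c z))^2 by ring]
            exact this
          · have := exp_point s (c z) hs0.le hs1 (hc0 z) (hc1 z)
            simp only [h]
            simpa using this
    _ = Real.exp (-(s/4)) * (1 + s/4 + s^2/4 - 2*s*∫ z, (polyW s (c z) - (if y z then (1:ℝ) else 0))^2 ∂D) := by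
        rw [integral_const_mul, integral_sub (integrable_const _) (hint1.const_mul _), integral_const_mul]
        simp
    _ ≤ Real.exp (-(s/4)) * Real.exp (s/4 + s^2/4 - 2*s*m) := by
        apply mul_le_mul_of_nonneg_left _ (Real.exp_pos _).le
        have := Real.add_one_le_exp (s/4 + s^2/4 - 2*s*m)
        nlinarith
    _ = _ := by rw [← Real.exp_add]; congr 1; ring

section core
open ProbabilityTheory

lemma argmin_exists {Z : Type*} {N : ℕ} (ℓ : ℕ → Z → ℝ) (h0 : ∀ j z, 0 ≤ ℓ j z) (γ : ℝ) (hγ : 0 < γ)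
    (A : Finset (Fin N)) (a : A → Z) :
    ∃ n, ∀ l, ∑ i, ℓ n (a i) ≤ ∑ i, ℓ l (a i) + γ := by
  have hb : BddBelow (Set.range fun n => ∑ i, ℓ n (a i)) :=
    ⟨0, by rintro _ ⟨n, rfl⟩; exact Finset.sum_nonneg fun i _ => h0 _ _⟩
  obtain ⟨n, hn⟩ := exists_lt_of_ciInf_lt (f := fun n => ∑ i, ℓ n (a i))
    (a := (⨅ n, ∑ i, ℓ n (a i)) + γ) (by linarith)
  refine ⟨n, fun l => ?_⟩
  have := ciInf_le hb l
  linarith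

open Classical in
noncomputable def argm {Z : Type*} {N : ℕ} (ℓ : ℕ → Z → ℝ) (h0 : ∀ j z, 0 ≤ ℓ j z) (γ : ℝ)
    (hγ : 0 < γ) (A : Finset (Fin N)) (a : A → Z) : ℕ := Nat.find (argmin_exists ℓ h0 γ hγ A a)

lemma argm_spec {Z : Type*} {N : ℕ} (ℓ : ℕ → Z → ℝ) (h0 : ∀ j z, 0 ≤ ℓ j z) (γ : ℝ)
    (hγ : 0 < γ) (A : Finset (Fin N)) (S : Fin N → Z) (l : ℕ) :
    ∑ i ∈ A, ℓ (argm ℓ h0 γ hγ A (fun i => S i)) (S i) ≤ ∑ i ∈ A, ℓ l (S i) + γ := by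
  classical
  have := Nat.find_spec (argmin_exists ℓ h0 γ hγ A (fun i => S i)) l
  have e : ∀ n, ∑ i : A, ℓ n (S i) = ∑ i ∈ A, ℓ n (S i) := fun n =>
    Finset.sum_coe_sort A (fun i => ℓ n (S i))
  rw [e, e] at this
  unfold argm
  convert this

lemma argm_meas {Z : Type*} [MeasurableSpace Z] {N : ℕ} (ℓ : ℕ → Z → ℝ) (h0 : ∀ j z, 0 ≤ ℓ j z) (γ : ℝ)
    (hγ : 0 < γ) (A : Finset (Fin N)) (hm : ∀ j, Measurable (ℓ j)) :
    Measurable (argm ℓ h0 γ hγ A) := by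
  classical
  unfold argm
  apply measurable_find
  intro k
  rw [Set.ofPred_forall]
  refine MeasurableSet.iInter fun l => measurableSet_le ?_ ?_
  · exact Finset.measurable_sum _ fun i _ => (hm _).comp (measurable_pi_apply i)
  · exact (Finset.measurable_sum _ fun i _ => (hm _).comp (measurable_pi_apply i)).add_const _

lemma cross_bound {Z : Type*} [MeasurableSpace Z] (D : Measure Z) [IsProbabilityMeasure D] {N : ℕ}
    (ℓ : ℕ → Z → ℝ) (h0 : ∀ j z, 0 ≤ ℓ j z) (γ : ℝ)
    (hγ : 0 < γ) (A B : Finset (Fin N)) (hAB : Disjoint A B) (hm : ∀ j, Measurable (ℓ j))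
    (μ κ : ℝ) (hμ : 0 ≤ μ) (hmgf : ∀ j, ∫ z, Real.exp (-μ * ℓ j z) ∂D ≤ Real.exp κ) :
    ∫⁻ S, ENNReal.ofReal (Real.exp (-μ * ∑ i ∈ B, ℓ (argm ℓ h0 γ hγ A (fun i => S i)) (S i)))
      ∂(Measure.pi fun _ : Fin N => D) ≤ ENNReal.ofReal (Real.exp (κ * B.card)) := by
  set ν := Measure.pi fun _ : Fin N => D
  have hind : iIndepFun (fun (i : Fin N) (S : Fin N → Z) => S i) ν :=
    iIndepFun_pi (X := fun _ z => z) (fun i => aemeasurable_id)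
  have h1 := hind.indepFun_finset A B hAB (fun i => measurable_pi_apply i)
  have h2 : IndepFun (fun S : Fin N → Z => argm ℓ h0 γ hγ A (fun i => S i))
      (fun (S : Fin N → Z) (i : B) => S i) ν :=
    h1.comp (argm_meas ℓ h0 γ hγ A hm) measurable_id
  have mJ : Measurable (fun S : Fin N → Z => argm ℓ h0 γ hγ A (fun i => S i)) :=
    (argm_meas ℓ h0 γ hγ A hm).comp (measurable_pi_lambda _ fun i => measurable_pi_apply _)
  have mB : Measurable (fun (S : Fin N → Z) (i : B) => S i) :=
    measurable_pi_lambda _ fun i => measurable_pi_apply _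
  have h3 := (indepFun_iff_map_prod_eq_prod_map_map mJ.aemeasurable mB.aemeasurable).1 h2
  have mG : ∀ j, Measurable fun z => ENNReal.ofReal (Real.exp (-μ * ℓ j z)) := fun j =>
    ENNReal.measurable_ofReal.comp (Real.measurable_exp.comp ((hm j).const_mul _))
  let F : ℕ × (B → Z) → ENNReal := fun q => ∏ i : B, ENNReal.ofReal (Real.exp (-μ * ℓ q.1 (q.2 i)))
  have mF : Measurable F := measurable_from_prod_countable_right fun n =>
    Finset.measurable_prod _ fun i _ => (mG n).comp (measurable_pi_apply i)
  have eF : ∀ S : Fin N → Z, ENNReal.ofReal (Real.exp (-μ * ∑ i ∈ B, ℓ (argm ℓ h0 γ hγ A (fun i => S i)) (S i)))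
      = F (argm ℓ h0 γ hγ A (fun i => S i), fun i => S i) := by
    intro S
    simp only [F]
    rw [Finset.mul_sum, Real.exp_sum, ENNReal.ofReal_prod_of_nonneg (fun _ _ => (Real.exp_pos _).le)]
    exact (Finset.prod_coe_sort B (fun i => ENNReal.ofReal (Real.exp (-μ * ℓ (argm ℓ h0 γ hγ A (fun i => S i)) (S i))))).symm
  have hlm : ∀ j, ∫⁻ z, ENNReal.ofReal (Real.exp (-μ * ℓ j z)) ∂D ≤ ENNReal.ofReal (Real.exp κ) := by
    intro j
    rw [← ofReal_integral_eq_lintegral_ofReal]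
    · exact ENNReal.ofReal_le_ofReal (hmgf j)
    · refine Integrable.of_bound (C := 1) ((Real.measurable_exp.comp ((hm j).const_mul _)).aestronglyMeasurable) (ae_of_all _ fun z => ?_)
      rw [Real.norm_eq_abs, abs_of_nonneg (Real.exp_pos _).le, Real.exp_le_one_iff]
      have := h0 j z
      nlinarith
    · exact ae_of_all _ fun z => (Real.exp_pos _).le
  have inner : ∀ n, ∫⁻ b, F (n, b) ∂(ν.map (fun (S : Fin N → Z) (i : B) => S i)) ≤
      ENNReal.ofReal (Real.exp (κ * B.card)) := by
    intro n
    have mFn : Measurable fun b => F (n, b) := mF.comp (measurable_const.prodMk measurable_id)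
    rw [lintegral_map mFn mB]
    have e : ∀ S : Fin N → Z, F (n, fun i => S i) = ∏ i ∈ B, ENNReal.ofReal (Real.exp (-μ * ℓ n (S i))) := by
      intro S
      exact Finset.prod_coe_sort B (fun i => ENNReal.ofReal (Real.exp (-μ * ℓ n (S i))))
    simp_rw [e]
    rw [lintegral_prod_eq_prod_lintegral_of_indepFun B
      (fun i (S : Fin N → Z) => ENNReal.ofReal (Real.exp (-μ * ℓ n (S i))))
      (hind.comp _ (fun _ => mG n)) (fun i => (mG n).comp (measurable_pi_apply i))]
    have e2 : ∀ i : Fin N, ∫⁻ S, ENNReal.ofReal (Real.exp (-μ * ℓ n (S i))) ∂ν ≤ ENNReal.ofReal (Real.exp κ) := by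
      intro i
      refine le_trans (le_of_eq ?_) (hlm n)
      exact (measurePreserving_eval (fun _ : Fin N => D) i).lintegral_comp (mG n)
    refine (Finset.prod_le_prod' fun i _ => e2 i).trans (le_of_eq ?_)
    rw [Finset.prod_const, ← ENNReal.ofReal_pow (Real.exp_pos _).le, ← Real.exp_nat_mul, mul_comm]
  simp_rw [eF]
  haveI : IsProbabilityMeasure (ν.map (fun S : Fin N → Z => argm ℓ h0 γ hγ A (fun i => S i))) :=
    Measure.isProbabilityMeasure_map mJ.aemeasurable
  calc ∫⁻ S, F (argm ℓ h0 γ hγ A (fun i => S i), fun i => S i) ∂ν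
      = ∫⁻ q, F q ∂(ν.map fun S => (argm ℓ h0 γ hγ A (fun i => S i), fun i : B => S i)) :=
        (lintegral_map mF (mJ.prodMk mB)).symm
    _ = _ := by rw [h3, lintegral_prod _ mF.aemeasurable]
    _ ≤ ∫⁻ n, ENNReal.ofReal (Real.exp (κ * B.card)) ∂(ν.map (fun S : Fin N → Z => argm ℓ h0 γ hγ A (fun i => S i))) :=
        lintegral_mono inner
    _ = _ := by simp

/-- The cross-validation quantity. -/
noncomputable def crossX {Z : Type*} {N : ℕ} (ℓ : ℕ → Z → ℝ) (h0 : ∀ j z, 0 ≤ ℓ j z) (γ : ℝ)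
    (hγ : 0 < γ) (A B : Finset (Fin N)) (S : Fin N → Z) : ℝ :=
  ∑ i ∈ B, ℓ (argm ℓ h0 γ hγ A (fun i => S i)) (S i)

def tS {N : ℕ} (ε : Fin N → Bool) : Finset (Fin N) := Finset.univ.filter fun i => ε i = true
def fS {N : ℕ} (ε : Fin N → Bool) : Finset (Fin N) := Finset.univ.filter fun i => ¬ ε i = true

lemma tS_disj {N : ℕ} (ε : Fin N → Bool) : Disjoint (tS ε) (fS ε) :=
  Finset.disjoint_filter_filter_not _ _ _

lemma tS_card {N : ℕ} (ε : Fin N → Bool) : ((tS ε).card : ℝ) + (fS ε).card = N := by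
  have := Finset.card_filter_add_card_filter_not (s := (Finset.univ : Finset (Fin N))) (fun i => ε i = true)
  rw [Finset.card_univ, Fintype.card_fin] at this
  unfold tS fS
  exact_mod_cast this

lemma sum_split {N : ℕ} (ε : Fin N → Bool) (g : Fin N → ℝ) :
    ∑ i, g i = ∑ i ∈ tS ε, g i + ∑ i ∈ fS ε, g i :=
  (Finset.sum_filter_add_sum_filter_not _ _ _).symm

lemma sum_sign {N : ℕ} (ε : Fin N → Bool) (g : Fin N → ℝ) :
    ∑ i, (if ε i then (1:ℝ) else -1) * g i = ∑ i ∈ tS ε, g i - ∑ i ∈ fS ε, g i := by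
  rw [sum_split ε]
  have h1 : ∑ i ∈ tS ε, (if ε i then (1:ℝ) else -1) * g i = ∑ i ∈ tS ε, g i :=
    Finset.sum_congr rfl fun i hi => by simp [tS] at hi; simp [hi]
  have h2 : ∑ i ∈ fS ε, (if ε i then (1:ℝ) else -1) * g i = - ∑ i ∈ fS ε, g i := by
    rw [← Finset.sum_neg_distrib]
    exact Finset.sum_congr rfl fun i hi => by simp [fS] at hi; simp [hi]
  rw [h1, h2]; ring

lemma sup_ge {Z : Type*} {N : ℕ} (hN : 1 ≤ N) (ℓ : ℕ → Z → ℝ) (h0 : ∀ j z, 0 ≤ ℓ j z)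
    (h1 : ∀ j z, ℓ j z ≤ 1) (S : Fin N → Z) (ε : Fin N → Bool) (j : ℕ) :
    ∑ i, (if ε i then (1:ℝ) else -1) * ℓ j (S i) ≤ N * sSup ((fun h : Z → ℝ =>
      (N : ℝ)⁻¹ * ∑ i : Fin N, (if ε i then (1 : ℝ) else -1) * h (S i)) '' Set.range ℓ) := by
  have hNp : (0:ℝ) < N := by exact_mod_cast hN
  have hb : BddAbove ((fun h : Z → ℝ =>
      (N : ℝ)⁻¹ * ∑ i : Fin N, (if ε i then (1 : ℝ) else -1) * h (S i)) '' Set.range ℓ) := by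
    refine ⟨(N:ℝ)⁻¹ * ∑ i : Fin N, 1, ?_⟩
    rintro _ ⟨_, ⟨k, rfl⟩, rfl⟩
    apply mul_le_mul_of_nonneg_left _ (by positivity)
    apply Finset.sum_le_sum
    intro i _
    have := h0 k (S i); have := h1 k (S i)
    split_ifs <;> linarith
  have := le_csSup hb ⟨ℓ j, ⟨j, rfl⟩, rfl⟩
  have h2 := mul_le_mul_of_nonneg_left this hNp.le
  dsimp only at h2
  rwa [mul_inv_cancel_left₀ hNp.ne'] at h2

lemma det_ineq {Z : Type*} {N : ℕ} (hN : 1 ≤ N) (ℓ : ℕ → Z → ℝ) (h0 : ∀ j z, 0 ≤ ℓ j z)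
    (h1 : ∀ j z, ℓ j z ≤ 1) (γ : ℝ) (hγ : 0 < γ) (S : Fin N → Z) (j : ℕ) :
    (2^N : ℝ)⁻¹ * ∑ ε : Fin N → Bool, (crossX ℓ h0 γ hγ (fS ε) (tS ε) S + crossX ℓ h0 γ hγ (tS ε) (fS ε) S)
      ≤ ∑ i, ℓ j (S i) + 2 * N * empRad S (Set.range ℓ) + 2 * γ := by
  set sp : (Fin N → Bool) → ℝ := fun ε => sSup ((fun h : Z → ℝ =>
      (N : ℝ)⁻¹ * ∑ i : Fin N, (if ε i then (1 : ℝ) else -1) * h (S i)) '' Set.range ℓ) with hsp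
  have hR : empRad S (Set.range ℓ) = (2^N : ℝ)⁻¹ * ∑ ε, sp ε := rfl
  let nt : (Fin N → Bool) ≃ (Fin N → Bool) := Equiv.piCongrRight fun _ => Equiv.boolNot
  have hnt : ∀ ε i, nt ε i = !(ε i) := fun ε i => rfl
  have htn : ∀ ε, tS (nt ε) = fS ε := by intro ε; ext i; simp [tS, fS, hnt]
  have hfn : ∀ ε, fS (nt ε) = tS ε := by intro ε; ext i; simp [tS, fS, hnt]
  have hsum : ∑ ε, sp ε = ∑ ε, sp (nt ε) := (Equiv.sum_comp nt sp).symm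
  have key : ∀ ε, crossX ℓ h0 γ hγ (fS ε) (tS ε) S + crossX ℓ h0 γ hγ (tS ε) (fS ε) S ≤
      ∑ i, ℓ j (S i) + 2 * γ + N * sp ε + N * sp (nt ε) := by
    intro ε
    have a1 := sup_ge hN ℓ h0 h1 S ε (argm ℓ h0 γ hγ (fS ε) (fun i => S i))
    have a2 := sup_ge hN ℓ h0 h1 S (nt ε) (argm ℓ h0 γ hγ (tS ε) (fun i => S i))
    rw [sum_sign] at a1 a2
    rw [htn, hfn] at a2
    have b1 := argm_spec ℓ h0 γ hγ (fS ε) S j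
    have b2 := argm_spec ℓ h0 γ hγ (tS ε) S j
    rw [sum_split ε]
    unfold crossX
    linarith
  have h2 : (0:ℝ) < 2^N := by positivity
  have tot := Finset.sum_le_sum fun ε (_ : ε ∈ Finset.univ) => key ε
  have e : ∑ ε, (∑ i, ℓ j (S i) + 2 * γ + N * sp ε + N * sp (nt ε)) =
      2^N * (∑ i, ℓ j (S i) + 2 * γ) + N * ∑ ε, sp ε + N * ∑ ε, sp ε := by
    rw [Finset.sum_add_distrib, Finset.sum_add_distrib, ← Finset.mul_sum, ← Finset.mul_sum, ← hsum,
      Finset.sum_const, Finset.card_univ, Fintype.card_fun, Fintype.card_bool, Fintype.card_fin, nsmul_eq_mul]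
    push_cast
    rfl
  rw [e] at tot
  rw [hR, inv_mul_le_iff₀ h2]
  refine tot.trans (le_of_eq ?_)
  field_simp
  ring

end core

section core2

lemma crossX_meas {Z : Type*} [MeasurableSpace Z] {N : ℕ} (ℓ : ℕ → Z → ℝ) (h0 : ∀ j z, 0 ≤ ℓ j z) (γ : ℝ)
    (hγ : 0 < γ) (A B : Finset (Fin N)) (hm : ∀ j, Measurable (ℓ j)) :
    Measurable (crossX ℓ h0 γ hγ A B) := by
  let F : ℕ × (Fin N → Z) → ℝ := fun q => ∑ i ∈ B, ℓ q.1 (q.2 i)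
  have mF : Measurable F := measurable_from_prod_countable_right fun n =>
    Finset.measurable_sum _ fun i _ => (hm n).comp (measurable_pi_apply i)
  have mJ : Measurable (fun S : Fin N → Z => argm ℓ h0 γ hγ A (fun i => S i)) :=
    (argm_meas ℓ h0 γ hγ A hm).comp (measurable_pi_lambda _ fun i => measurable_pi_apply _)
  exact mF.comp (mJ.prodMk measurable_id)

lemma amgm_exp (x y u : ℝ) :
    Real.exp (-(x + y)) ≤ 1/2 * (Real.exp (u) * Real.exp (-(2*x))) + 1/2 * (Real.exp (-u) * Real.exp (-(2*y))) := by
  rw [← Real.exp_add, ← Real.exp_add]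
  have h1 := sq_nonneg (Real.exp ((u + -(2*x))/2) - Real.exp ((-u + -(2*y))/2))
  have e1 : Real.exp (u + -(2*x)) = Real.exp ((u + -(2*x))/2) ^ 2 := by
    rw [← Real.exp_nat_mul]; congr 1; push_cast; ring
  have e2 : Real.exp (-u + -(2*y)) = Real.exp ((-u + -(2*y))/2) ^ 2 := by
    rw [← Real.exp_nat_mul]; congr 1; push_cast; ring
  have e3 : Real.exp (-(x+y)) = Real.exp ((u + -(2*x))/2) * Real.exp ((-u + -(2*y))/2) := by
    rw [← Real.exp_add]; congr 1; ring
  rw [e1, e2, e3]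
  nlinarith

lemma pair_bound {Z : Type*} [MeasurableSpace Z] (D : Measure Z) [IsProbabilityMeasure D] {N : ℕ}
    (ℓ : ℕ → Z → ℝ) (h0 : ∀ j z, 0 ≤ ℓ j z) (γ : ℝ)
    (hγ : 0 < γ) (hm : ∀ j, Measurable (ℓ j))
    (lam θ : ℝ) (hl : 0 ≤ lam) (hmgf : ∀ j, ∫ z, Real.exp (-(2*lam) * ℓ j z) ∂D ≤ Real.exp (2*θ))
    (ε : Fin N → Bool) :
    ∫⁻ S, ENNReal.ofReal (Real.exp (-(lam * (crossX ℓ h0 γ hγ (fS ε) (tS ε) S + crossX ℓ h0 γ hγ (tS ε) (fS ε) S))))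
      ∂(Measure.pi fun _ : Fin N => D) ≤ ENNReal.ofReal (Real.exp (θ * N)) := by
  set ν := Measure.pi fun _ : Fin N => D
  set X := crossX ℓ h0 γ hγ (fS ε) (tS ε)
  set Y := crossX ℓ h0 γ hγ (tS ε) (fS ε)
  have mX : Measurable X := crossX_meas ℓ h0 γ hγ _ _ hm
  have mY : Measurable Y := crossX_meas ℓ h0 γ hγ _ _ hm
  have bX : ∫⁻ S, ENNReal.ofReal (Real.exp (-(2*lam) * X S)) ∂ν ≤ ENNReal.ofReal (Real.exp (2*θ * (tS ε).card)) :=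
    cross_bound D ℓ h0 γ hγ (fS ε) (tS ε) (tS_disj ε).symm hm (2*lam) (2*θ) (by linarith) hmgf
  have bY : ∫⁻ S, ENNReal.ofReal (Real.exp (-(2*lam) * Y S)) ∂ν ≤ ENNReal.ofReal (Real.exp (2*θ * (fS ε).card)) :=
    cross_bound D ℓ h0 γ hγ (tS ε) (fS ε) (tS_disj ε) hm (2*lam) (2*θ) (by linarith) hmgf
  have mX' : Measurable fun S => ENNReal.ofReal (Real.exp (-(2*lam) * X S)) :=
    ENNReal.measurable_ofReal.comp (Real.measurable_exp.comp (mX.const_mul _))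
  have mY' : Measurable fun S => ENNReal.ofReal (Real.exp (-(2*lam) * Y S)) :=
    ENNReal.measurable_ofReal.comp (Real.measurable_exp.comp (mY.const_mul _))
  set u : ℝ := θ * ((fS ε).card - (tS ε).card)
  have hc := tS_card ε
  calc _ ≤ ∫⁻ S, (ENNReal.ofReal (1/2 * Real.exp u) * ENNReal.ofReal (Real.exp (-(2*lam) * X S))
          + ENNReal.ofReal (1/2 * Real.exp (-u)) * ENNReal.ofReal (Real.exp (-(2*lam) * Y S))) ∂ν := by
        apply lintegral_mono
        intro S
        dsimp only
        rw [← ENNReal.ofReal_mul (by positivity), ← ENNReal.ofReal_mul (by positivity),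
          ← ENNReal.ofReal_add (by positivity) (by positivity)]
        apply ENNReal.ofReal_le_ofReal
        have := amgm_exp (lam * X S) (lam * Y S) u
        rw [show lam * (X S + Y S) = lam * X S + lam * Y S by ring,
          show -(2*lam) * X S = -(2 * (lam * X S)) by ring, show -(2*lam) * Y S = -(2 * (lam * Y S)) by ring]
        linarith
    _ = ENNReal.ofReal (1/2 * Real.exp u) * ∫⁻ S, ENNReal.ofReal (Real.exp (-(2*lam) * X S)) ∂ν
        + ENNReal.ofReal (1/2 * Real.exp (-u)) * ∫⁻ S, ENNReal.ofReal (Real.exp (-(2*lam) * Y S)) ∂ν := by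
        rw [lintegral_add_left (mX'.const_mul _), lintegral_const_mul _ mX', lintegral_const_mul _ mY']
    _ ≤ ENNReal.ofReal (1/2 * Real.exp u) * ENNReal.ofReal (Real.exp (2*θ * (tS ε).card))
        + ENNReal.ofReal (1/2 * Real.exp (-u)) * ENNReal.ofReal (Real.exp (2*θ * (fS ε).card)) := by gcongr
    _ = _ := by
        rw [← ENNReal.ofReal_mul (by positivity), ← ENNReal.ofReal_mul (by positivity),
          ← ENNReal.ofReal_add (by positivity) (by positivity)]
        congr 1
        rw [mul_assoc (1/2) (Real.exp u), mul_assoc (1/2) (Real.exp (-u)), ← Real.exp_add, ← Real.exp_add, ← hc]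
        rw [show u + 2*θ * (tS ε).card = θ * ((tS ε).card + (fS ε).card) by simp only [u]; ring,
          show -u + 2*θ * (fS ε).card = θ * ((tS ε).card + (fS ε).card) by simp only [u]; ring]
        ring

lemma core_gamma {Z : Type*} [MeasurableSpace Z] (D : Measure Z) [IsProbabilityMeasure D] {N : ℕ} (hN : 1 ≤ N)
    (ℓ : ℕ → Z → ℝ) (h0 : ∀ j z, 0 ≤ ℓ j z) (h1 : ∀ j z, ℓ j z ≤ 1) (hm : ∀ j, Measurable (ℓ j))
    (m t : ℝ) (ht : 0 < t) (hmgf : ∀ j, ∫ z, Real.exp (-(8*t) * ℓ j z) ∂D ≤ Real.exp (4*t^2 - 8*t*m))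
    (γ : ℝ) (hγ : 0 < γ) :
    (Measure.pi fun _ : Fin N => D) {S | ∃ j, (N:ℝ)⁻¹ * ∑ i, ℓ j (S i) + 2 * empRad S (Set.range ℓ) + t < m}
      ≤ ENNReal.ofReal (Real.exp (-2 * N * t^2 + 8*t*γ)) := by
  set ν := Measure.pi fun _ : Fin N => D
  have hNp : (0:ℝ) < N := by exact_mod_cast hN
  have h2 : (0:ℝ) < 2^N := by positivity
  set X : (Fin N → Bool) → (Fin N → Z) → ℝ := fun ε S =>
    crossX ℓ h0 γ hγ (fS ε) (tS ε) S + crossX ℓ h0 γ hγ (tS ε) (fS ε) S with hX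
  set q : ℝ := N * (m - t) + 2 * γ
  set U : (Fin N → Z) → ENNReal := fun S => ∑ ε, ENNReal.ofReal (Real.exp (-(4*t * X ε S))) with hU
  have mT : ∀ ε, Measurable fun S => ENNReal.ofReal (Real.exp (-(4*t * X ε S))) := fun ε =>
    ENNReal.measurable_ofReal.comp (Real.measurable_exp.comp
      ((((crossX_meas ℓ h0 γ hγ _ _ hm).add (crossX_meas ℓ h0 γ hγ _ _ hm)).const_mul _).neg))
  have mU : Measurable U := Finset.measurable_sum _ fun ε _ => mT ε
  have EU : ∫⁻ S, U S ∂ν ≤ ENNReal.ofReal (2^N * Real.exp ((2*t^2 - 4*t*m) * N)) := by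
    simp only [hU]
    rw [lintegral_finsetSum _ fun ε _ => mT ε]
    refine (Finset.sum_le_sum fun ε _ => pair_bound D ℓ h0 γ hγ hm (4*t) (2*t^2-4*t*m) (by linarith) ?_ ε).trans (le_of_eq ?_)
    · intro j
      have := hmgf j
      rw [show 2 * (4*t) = 8*t by ring, show 2*(2*t^2-4*t*m) = 4*t^2 - 8*t*m by ring]
      exact this
    · rw [Finset.sum_const, Finset.card_univ, Fintype.card_fun, Fintype.card_bool, Fintype.card_fin, nsmul_eq_mul,
        ENNReal.ofReal_mul (by positivity), ENNReal.ofReal_pow (by positivity)]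
      push_cast
      simp
  have sub : {S | ∃ j, (N:ℝ)⁻¹ * ∑ i, ℓ j (S i) + 2 * empRad S (Set.range ℓ) + t < m} ⊆
      {S | ENNReal.ofReal (2^N * Real.exp (-(4*t*q))) ≤ U S} := by
    rintro S ⟨j, hj⟩
    have hd : (2^N : ℝ)⁻¹ * ∑ ε : Fin N → Bool, X ε S ≤ _ := det_ineq hN ℓ h0 h1 γ hγ S j
    have hq : ∑ ε : Fin N → Bool, X ε S ≤ 2^N * q := by
      rw [inv_mul_le_iff₀ h2] at hd
      refine hd.trans (mul_le_mul_of_nonneg_left ?_ h2.le)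
      have := mul_le_mul_of_nonneg_left hj.le hNp.le
      have e : (N:ℝ) * ((N:ℝ)⁻¹ * ∑ i, ℓ j (S i) + 2 * empRad S (Set.range ℓ) + t) =
        ∑ i, ℓ j (S i) + 2 * N * empRad S (Set.range ℓ) + N * t := by field_simp
      rw [e] at this
      simp only [q]
      linarith
    change _ ≤ U S
    simp only [hU]
    rw [← ENNReal.ofReal_sum_of_nonneg fun _ _ => (Real.exp_pos _).le]
    apply ENNReal.ofReal_le_ofReal
    have pt : ∀ ε : Fin N → Bool, Real.exp (-(4*t*q)) * (1 + 4*t*q - 4*t*X ε S) ≤ Real.exp (-(4*t*X ε S)) := by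
      intro ε
      have := Real.add_one_le_exp (4*t*q - 4*t*X ε S)
      calc _ ≤ Real.exp (-(4*t*q)) * Real.exp (4*t*q - 4*t*X ε S) := by
            apply mul_le_mul_of_nonneg_left _ (Real.exp_pos _).le; linarith
        _ = _ := by rw [← Real.exp_add]; congr 1; ring
    refine le_trans ?_ (Finset.sum_le_sum fun ε _ => pt ε)
    rw [← Finset.mul_sum, Finset.sum_sub_distrib, ← Finset.mul_sum, Finset.sum_const, Finset.card_univ, Fintype.card_fun, Fintype.card_bool, Fintype.card_fin, nsmul_eq_mul]
    push_cast
    rw [mul_comm]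
    apply mul_le_mul_of_nonneg_left _ (Real.exp_pos _).le
    nlinarith
  have hpos : 0 < 2^N * Real.exp (-(4*t*q)) := by positivity
  have mk := mul_meas_ge_le_lintegral (μ := ν) mU (ENNReal.ofReal (2^N * Real.exp (-(4*t*q))))
  have step : ENNReal.ofReal (2^N * Real.exp (-(4*t*q))) * ν {S | ∃ j, (N:ℝ)⁻¹ * ∑ i, ℓ j (S i) + 2 * empRad S (Set.range ℓ) + t < m}
      ≤ ENNReal.ofReal (2^N * Real.exp (-(4*t*q))) * ENNReal.ofReal (Real.exp (-2 * N * t^2 + 8*t*γ)) := by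
    refine ((mul_le_mul_right (measure_mono sub) _).trans (mk.trans EU)).trans (le_of_eq ?_)
    rw [← ENNReal.ofReal_mul hpos.le, mul_assoc (2^N) (Real.exp _), ← Real.exp_add]
    congr 3
    simp only [q]; ring
  rwa [ENNReal.mul_le_mul_iff_right (by simpa using hpos) ENNReal.ofReal_ne_top] at step

lemma core_bound {Z : Type*} [MeasurableSpace Z] (D : Measure Z) [IsProbabilityMeasure D] {N : ℕ} (hN : 1 ≤ N)
    (ℓ : ℕ → Z → ℝ) (h0 : ∀ j z, 0 ≤ ℓ j z) (h1 : ∀ j z, ℓ j z ≤ 1) (hm : ∀ j, Measurable (ℓ j))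
    (m t : ℝ) (ht : 0 < t) (hmgf : ∀ j, ∫ z, Real.exp (-(8*t) * ℓ j z) ∂D ≤ Real.exp (4*t^2 - 8*t*m)) :
    (Measure.pi fun _ : Fin N => D) {S | ∃ j, (N:ℝ)⁻¹ * ∑ i, ℓ j (S i) + 2 * empRad S (Set.range ℓ) + t < m}
      ≤ ENNReal.ofReal (Real.exp (-2 * N * t^2)) := by
  have hT : Filter.Tendsto (fun γ : ℝ => ENNReal.ofReal (Real.exp (-2 * N * t^2 + 8*t*γ)))
      (nhdsWithin 0 (Set.Ioi 0)) (nhds (ENNReal.ofReal (Real.exp (-2 * N * t^2)))) := by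
    have : Continuous (fun γ : ℝ => ENNReal.ofReal (Real.exp (-2 * N * t^2 + 8*t*γ))) := by
      apply ENNReal.continuous_ofReal.comp; fun_prop
    have h := (this.tendsto 0).mono_left (nhdsWithin_le_nhds (s := Set.Ioi 0))
    simpa using h
  refine ge_of_tendsto hT ?_
  filter_upwards [self_mem_nhdsWithin] with γ hγ
  exact core_gamma D hN ℓ h0 h1 hm m t ht hmgf γ hγ

lemma emp_nonneg {Z : Type*} {N : ℕ} (hN : 1 ≤ N) (ℓ : ℕ → Z → ℝ) (h0 : ∀ j z, 0 ≤ ℓ j z)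
    (h1 : ∀ j z, ℓ j z ≤ 1) (S : Fin N → Z) (j : ℕ) :
    0 ≤ (N:ℝ)⁻¹ * ∑ i, ℓ j (S i) + 2 * empRad S (Set.range ℓ) := by
  have hNp : (0:ℝ) < N := by exact_mod_cast hN
  have : 0 ≤ ∑ i, ℓ j (S i) + 2 * N * empRad S (Set.range ℓ) := by
    apply le_of_forall_pos_le_add
    intro e he
    have := det_ineq hN ℓ h0 h1 (e/2) (by positivity) S j
    refine le_trans ?_ (this.trans (by linarith))
    apply mul_nonneg (by positivity)
    apply Finset.sum_nonneg
    intro ε _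
    exact add_nonneg (Finset.sum_nonneg fun _ _ => h0 _ _) (Finset.sum_nonneg fun _ _ => h0 _ _)
  have e : (N:ℝ)⁻¹ * ∑ i, ℓ j (S i) + 2 * empRad S (Set.range ℓ) = (N:ℝ)⁻¹ * (∑ i, ℓ j (S i) + 2 * N * empRad S (Set.range ℓ)) := by
    field_simp
  rw [e]; positivity

end core2

section approx

lemma sigmoid_cont : Continuous sigmoid := by
  unfold sigmoid
  exact continuous_const.div (by fun_prop) fun t => by positivity

lemma sigmoid_mem (t : ℝ) : 0 < sigmoid t ∧ sigmoid t < 1 := by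
  unfold sigmoid
  have := Real.exp_pos (-t)
  refine ⟨by positivity, ?_⟩
  rw [div_lt_one (by positivity)]
  linarith

lemma sigmoid_inj : Function.Injective sigmoid := by
  intro a b h
  unfold sigmoid at h
  have ha := Real.exp_pos (-a)
  have hb := Real.exp_pos (-b)
  rw [div_eq_div_iff (by positivity) (by positivity)] at h
  have : Real.exp (-a) = Real.exp (-b) := by linarith
  have := Real.exp_injective this
  linarith

lemma sigmoid_logit (h : ℝ) (h0 : 0 < h) (h1 : h < 1) : sigmoid (Real.log (h / (1 - h))) = h := by
  have h2 : 0 < 1 - h := by linarith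
  unfold sigmoid
  rw [← Real.log_inv, Real.exp_log (by positivity)]
  field_simp
  ring

lemma exp_sig (u s : ℝ) : |Real.exp s * sigmoid (u + -s) - Real.exp u| ≤ Real.exp u ^ 2 * Real.exp (-s) := by
  have e : Real.exp s * sigmoid (u + -s) - Real.exp u = - (Real.exp u ^ 2 * Real.exp (-s)) / (1 + Real.exp u * Real.exp (-s)) := by
    unfold sigmoid
    rw [show -(u + -s) = s + -u by ring, Real.exp_add, Real.exp_neg, Real.exp_neg]
    have := Real.exp_pos u
    have := Real.exp_pos s
    field_simp
    ring
  have := Real.exp_pos u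
  have := Real.exp_pos (-s)
  rw [e, abs_div, abs_neg, abs_of_nonneg (by positivity), abs_of_nonneg (by positivity)]
  apply div_le_self (by positivity)
  have : 0 < Real.exp u * Real.exp (-s) := by positivity
  linarith

lemma univ_approx {ι K : Type*} [Fintype ι] [TopologicalSpace K] [CompactSpace K] (Φ : K → ι → ℝ)
    (hc : Continuous Φ) (hinj : Function.Injective Φ) (g : C(K, ℝ)) (e : ℝ) (he : 0 < e) :
    ∃ (d : ℕ) (A : Matrix (Fin d) ι ℝ) (b a : Fin d → ℝ),
      ∀ x, |∑ i, a i * sigmoid (A.mulVec (Φ x) i + b i) - g x| < e := by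
  classical
  have hd : ∀ w : ι → ℝ, Continuous fun x => w ⬝ᵥ Φ x := fun w => by
    unfold dotProduct
    exact continuous_finsetSum _ fun i _ => continuous_const.mul ((continuous_apply i).comp hc)
  let sg : (ι → ℝ) × ℝ → C(K, ℝ) := fun q => ⟨fun x => sigmoid (q.1 ⬝ᵥ Φ x + q.2), sigmoid_cont.comp ((hd _).add continuous_const)⟩
  let ex : (ι → ℝ) → C(K, ℝ) := fun w => ⟨fun x => Real.exp (w ⬝ᵥ Φ x), Real.continuous_exp.comp (hd w)⟩
  let V : Submodule ℝ C(K, ℝ) := Submodule.span ℝ (Set.range sg)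
  have hex : ∀ w, ex w ∈ V.topologicalClosure := by
    intro w
    change ex w ∈ closure (V : Set C(K, ℝ))
    rw [Metric.mem_closure_iff]
    intro ε hε
    have hT : Filter.Tendsto (fun s : ℝ => ‖ex w‖ ^ 2 * Real.exp (-s)) Filter.atTop (nhds (‖ex w‖^2 * 0)) :=
      (Real.tendsto_exp_neg_atTop_nhds_zero).const_mul _
    rw [mul_zero] at hT
    obtain ⟨s, hs⟩ := ((hT.eventually (gt_mem_nhds hε))).exists
    refine ⟨Real.exp s • sg (w, -s), V.smul_mem _ (Submodule.subset_span ⟨_, rfl⟩), ?_⟩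
    rw [dist_comm, ContinuousMap.dist_lt_iff hε]
    intro x
    have h1 := exp_sig (w ⬝ᵥ Φ x) s
    have h2 : Real.exp (w ⬝ᵥ Φ x) ≤ ‖ex w‖ := (le_abs_self _).trans ((ex w).norm_coe_le_norm x)
    have h3 := Real.exp_pos (w ⬝ᵥ Φ x)
    rw [Real.dist_eq]
    refine lt_of_le_of_lt h1 (lt_of_le_of_lt ?_ hs)
    gcongr
  have hadj : ∀ v ∈ Algebra.adjoin ℝ (Set.range ex), v ∈ V.topologicalClosure := by
    let M : Submonoid C(K, ℝ) :=
      { carrier := Set.range ex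
        mul_mem' := by
          rintro _ _ ⟨u, rfl⟩ ⟨v, rfl⟩
          refine ⟨u + v, ?_⟩
          ext x
          change Real.exp _ = Real.exp _ * Real.exp _
          rw [add_dotProduct, Real.exp_add]
        one_mem' := ⟨0, by ext x; change Real.exp _ = 1; simp⟩ }
    have hM : Submonoid.closure (Set.range ex) = M := Submonoid.closure_eq M
    intro v hv
    have : v ∈ Subalgebra.toSubmodule (Algebra.adjoin ℝ (Set.range ex)) := hv
    rw [Algebra.adjoin_eq_span, hM] at this
    refine (Submodule.span_le.2 ?_) this
    rintro _ ⟨w, rfl⟩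
    exact hex w
  have hsep : (Algebra.adjoin ℝ (Set.range ex)).SeparatesPoints := by
    intro x y hxy
    have : Φ x ≠ Φ y := fun h => hxy (hinj h)
    obtain ⟨i, hi⟩ := Function.ne_iff.1 this
    refine ⟨ex (Pi.single i 1), ⟨_, Algebra.subset_adjoin ⟨_, rfl⟩, rfl⟩, ?_⟩
    change Real.exp _ ≠ Real.exp _
    simpa using hi
  have htop := ContinuousMap.subalgebra_topologicalClosure_eq_top_of_separatesPoints _ hsep
  have hg : g ∈ closure (V : Set C(K, ℝ)) := by
    have h1 : g ∈ (Algebra.adjoin ℝ (Set.range ex)).topologicalClosure := by rw [htop]; trivial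
    have h2 : g ∈ closure ((Algebra.adjoin ℝ (Set.range ex) : Subalgebra ℝ C(K, ℝ)) : Set C(K, ℝ)) := h1
    have h3 := closure_mono (fun v hv => hadj v hv : ((Algebra.adjoin ℝ (Set.range ex) : Subalgebra ℝ C(K, ℝ)) : Set C(K, ℝ)) ⊆ closure (V : Set C(K, ℝ))) h2
    have h4 : g ∈ closure (closure (V : Set C(K, ℝ))) := h3
    rwa [closure_closure] at h4
  obtain ⟨v, hv, hdist⟩ := Metric.mem_closure_iff.1 hg e he
  obtain ⟨d, a, q, rfl⟩ := Submodule.mem_span_set'.1 hv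
  choose w hw using fun i => (q i).2
  refine ⟨d, fun i => (w i).1, fun i => (w i).2, a, fun x => ?_⟩
  rw [dist_comm, ContinuousMap.dist_lt_iff he] at hdist
  have := hdist x
  rw [Real.dist_eq] at this
  convert this using 3
  rw [ContinuousMap.sum_apply]
  refine Finset.sum_congr rfl fun i _ => ?_
  rw [← hw i]
  rfl

lemma conv_cont {p : ℕ} (hp : 3 ≤ p) (k : Matrix (Fin 3) (Fin 3) ℝ) (i j) :
    Continuous fun x : Matrix (Fin p) (Fin p) ℝ => conv2d p p 3 hp hp k x i j := by
  unfold conv2d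
  refine continuous_finsetSum _ fun s _ => continuous_finsetSum _ fun t _ => ?_
  exact (continuous_id.matrix_elem _ _).mul continuous_const

lemma conv_meas {p : ℕ} (hp : 3 ≤ p) (k : Matrix (Fin 3) (Fin 3) ℝ) (i j) :
    Measurable fun x : Matrix (Fin p) (Fin p) ℝ => conv2d p p 3 hp hp k x i j := by
  unfold conv2d
  refine Finset.measurable_sum _ fun s _ => Finset.measurable_sum _ fun t _ => Measurable.mul_const ?_ _
  generalize (⟨i.val + s.val, _⟩ : Fin p) = a
  generalize (⟨j.val + t.val, _⟩ : Fin p) = b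
  have h1 : Measurable (fun x : Fin p → Fin p → ℝ => x a b) := (measurable_pi_apply b).comp (measurable_pi_apply a)
  exact h1

lemma out_cont {p d₀ d₁ : ℕ} (hp : 3 ≤ p) (ker : Fin d₀ → Matrix (Fin 3) (Fin 3) ℝ)
    (b₀ : Fin d₀ × Fin (p - 3 + 1) × Fin (p - 3 + 1) → ℝ)
    (A₁ : Matrix (Fin d₁) (Fin d₀ × Fin (p - 3 + 1) × Fin (p - 3 + 1)) ℝ)
    (b₁ : Fin d₁ → ℝ) (a₂ : Fin d₁ → ℝ) (b₂ : ℝ) : Continuous (cnnOut hp ker b₀ A₁ b₁ a₂ b₂) := by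
  unfold cnnOut
  refine Continuous.add (continuous_finsetSum _ fun i _ => continuous_const.mul (sigmoid_cont.comp (Continuous.add ?_ continuous_const))) continuous_const
  unfold Matrix.mulVec dotProduct
  exact continuous_finsetSum _ fun q _ => continuous_const.mul (sigmoid_cont.comp ((conv_cont hp _ _ _).add continuous_const))

lemma out_meas {p d₀ d₁ : ℕ} (hp : 3 ≤ p) (ker : Fin d₀ → Matrix (Fin 3) (Fin 3) ℝ)
    (b₀ : Fin d₀ × Fin (p - 3 + 1) × Fin (p - 3 + 1) → ℝ)
    (A₁ : Matrix (Fin d₁) (Fin d₀ × Fin (p - 3 + 1) × Fin (p - 3 + 1)) ℝ)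
    (b₁ : Fin d₁ → ℝ) (a₂ : Fin d₁ → ℝ) (b₂ : ℝ) : Measurable (cnnOut hp ker b₀ A₁ b₁ a₂ b₂) := by
  unfold cnnOut
  refine Measurable.add_const (Finset.measurable_sum _ fun i _ => Measurable.const_mul (sigmoid_cont.measurable.comp (Measurable.add_const ?_ _)) _) _
  unfold Matrix.mulVec dotProduct
  exact Finset.measurable_sum _ fun q _ => Measurable.const_mul (sigmoid_cont.measurable.comp ((conv_meas hp _ _ _).add_const _)) _

lemma lab_meas {p : ℕ} : Measurable fun z : Matrix (Fin p) (Fin p) ℝ × Bool => (if z.2 then (1:ℝ) else 0) :=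
  (measurable_of_countable (fun b : Bool => if b then (1:ℝ) else 0)).comp measurable_snd

lemma sq_mem (c : ℝ) (h0 : 0 < c) (h1 : c < 1) (b : Bool) :
    0 ≤ (c - (if b then (1:ℝ) else 0))^2 ∧ (c - (if b then (1:ℝ) else 0))^2 ≤ 1 := by
  refine ⟨sq_nonneg _, ?_⟩
  cases b <;> simp <;> rw [abs_le] <;> constructor <;> linarith

lemma loss_meas {p d₀ d₁ : ℕ} (hp : 3 ≤ p) (ker : Fin d₀ → Matrix (Fin 3) (Fin 3) ℝ)
    (b₀ : Fin d₀ × Fin (p - 3 + 1) × Fin (p - 3 + 1) → ℝ)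
    (A₁ : Matrix (Fin d₁) (Fin d₀ × Fin (p - 3 + 1) × Fin (p - 3 + 1)) ℝ)
    (b₁ : Fin d₁ → ℝ) (a₂ : Fin d₁ → ℝ) (b₂ : ℝ) : Measurable (cnnLoss hp ker b₀ A₁ b₁ a₂ b₂) := by
  unfold cnnLoss
  exact ((sigmoid_cont.measurable.comp ((out_meas hp ker b₀ A₁ b₁ a₂ b₂).comp measurable_fst)).sub lab_meas).pow_const 2

lemma loss_mem {p d₀ d₁ : ℕ} (hp : 3 ≤ p) (ker : Fin d₀ → Matrix (Fin 3) (Fin 3) ℝ)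
    (b₀ : Fin d₀ × Fin (p - 3 + 1) × Fin (p - 3 + 1) → ℝ)
    (A₁ : Matrix (Fin d₁) (Fin d₀ × Fin (p - 3 + 1) × Fin (p - 3 + 1)) ℝ)
    (b₁ : Fin d₁ → ℝ) (a₂ : Fin d₁ → ℝ) (b₂ : ℝ) (z) :
    0 ≤ cnnLoss hp ker b₀ A₁ b₁ a₂ b₂ z ∧ cnnLoss hp ker b₀ A₁ b₁ a₂ b₂ z ≤ 1 :=
  sq_mem _ (sigmoid_mem _).1 (sigmoid_mem _).2 _

lemma net_approx {p od : ℕ} (hp : 3 ≤ p) (ker : Fin od → Matrix (Fin 3) (Fin 3) ℝ)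
    (hinj : Function.Injective (fun x : Matrix (Fin p) (Fin p) ℝ => fun t : Fin od => conv2d p p 3 hp hp (ker t) x))
    (g : Matrix (Fin p) (Fin p) ℝ → ℝ) (hg : Continuous g) (r e : ℝ) (he : 0 < e) :
    ∃ (d : ℕ) (A : Matrix (Fin d) (Fin od × Fin (p - 3 + 1) × Fin (p - 3 + 1)) ℝ) (b a : Fin d → ℝ),
      ∀ x : Matrix (Fin p) (Fin p) ℝ, (∀ i j, x i j ∈ Set.Icc (-r) r) → |cnnOut hp ker 0 A b a 0 x - g x| < e := by
  let K : Set (Matrix (Fin p) (Fin p) ℝ) := {x | ∀ i j, x i j ∈ Set.Icc (-r) r}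
  have hK : IsCompact K := by
    have : IsCompact (Set.pi Set.univ fun _ : Fin p => Set.pi Set.univ fun _ : Fin p => Set.Icc (-r) r) :=
      isCompact_univ_pi fun _ => isCompact_univ_pi fun _ => isCompact_Icc
    have e : (Set.pi Set.univ fun _ : Fin p => Set.pi Set.univ fun _ : Fin p => Set.Icc (-r) r) =
        {x : Fin p → Fin p → ℝ | ∀ i j, x i j ∈ Set.Icc (-r) r} := by
      ext x
      simp only [Set.mem_pi, Set.mem_univ, true_imp_iff, Set.mem_setOf_eq]
    rw [e] at this
    exact this
  haveI : CompactSpace K := isCompact_iff_compactSpace.1 hK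
  let Φ : K → (Fin od × Fin (p - 3 + 1) × Fin (p - 3 + 1)) → ℝ := fun x q =>
    sigmoid (conv2d p p 3 hp hp (ker q.1) x.1 q.2.1 q.2.2 + 0)
  have hΦ : Continuous Φ := continuous_pi fun q =>
    sigmoid_cont.comp (((conv_cont hp _ _ _).comp continuous_subtype_val).add continuous_const)
  have hΦi : Function.Injective Φ := by
    intro x y h
    apply Subtype.ext
    apply hinj
    funext t i j
    have := sigmoid_inj (congrFun h (t, i, j))
    simpa using this
  obtain ⟨d, A, b, a, h⟩ := univ_approx Φ hΦ hΦi ⟨fun x => g x.1, hg.comp continuous_subtype_val⟩ e he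
  refine ⟨d, A, b, a, fun x hx => ?_⟩
  have := h ⟨x, hx⟩
  unfold cnnOut
  rw [add_zero]
  exact this

lemma inf_le {p od : ℕ} (hp : 3 ≤ p) (D : Measure (Matrix (Fin p) (Fin p) ℝ × Bool)) [IsProbabilityMeasure D]
    (ker : Fin od → Matrix (Fin 3) (Fin 3) ℝ)
    (hinj : Function.Injective (fun x : Matrix (Fin p) (Fin p) ℝ => fun t : Fin od => conv2d p p 3 hp hp (ker t) x))
    (h : Matrix (Fin p) (Fin p) ℝ → ℝ) (hh : Continuous h) (h0 : ∀ x, 0 < h x) (h1 : ∀ x, h x < 1)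
    (m : ℝ) (hm : ∀ (d : ℕ) (A : Matrix (Fin d) (Fin od × Fin (p - 3 + 1) × Fin (p - 3 + 1)) ℝ) (b a : Fin d → ℝ),
      m ≤ ∫ z, cnnLoss hp ker 0 A b a 0 z ∂D) :
    m ≤ ∫ z, (h z.1 - (if z.2 then (1:ℝ) else 0))^2 ∂D := by
  have hg : Continuous fun x => Real.log (h x / (1 - h x)) := by
    apply Continuous.log
    · exact hh.div (continuous_const.sub hh) fun x => by linarith [h1 x]
    · intro x
      have := h1 x
      have h2 : 0 < 1 - h x := by linarith
      have := h0 x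
      positivity
  choose d A b a H using fun r : ℕ => net_approx hp ker hinj _ hg r (1/((r:ℝ)+1)) (by positivity)
  have hlim : Filter.Tendsto (fun r : ℕ => ∫ z, cnnLoss hp ker 0 (A r) (b r) (a r) 0 z ∂D) Filter.atTop
      (nhds (∫ z, (h z.1 - (if z.2 then (1:ℝ) else 0))^2 ∂D)) := by
    refine tendsto_integral_of_dominated_convergence (fun _ => 1) (fun r => (loss_meas hp ker _ _ _ _ _).aestronglyMeasurable)
      (integrable_const _) (fun r => ae_of_all _ fun z => ?_) (ae_of_all _ fun z => ?_)
    · have := loss_mem hp ker 0 (A r) (b r) (a r) 0 z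
      rw [Real.norm_eq_abs, abs_of_nonneg this.1]
      exact this.2
    · have ht : Filter.Tendsto (fun r : ℕ => cnnOut hp ker 0 (A r) (b r) (a r) 0 z.1) Filter.atTop
          (nhds (Real.log (h z.1 / (1 - h z.1)))) := by
        rw [tendsto_iff_dist_tendsto_zero]
        refine squeeze_zero' (Filter.Eventually.of_forall fun _ => dist_nonneg) ?_ tendsto_one_div_add_atTop_nhds_zero_nat
        obtain ⟨R, hR⟩ := exists_nat_ge (∑ i, ∑ j, |z.1 i j|)
        filter_upwards [Filter.eventually_ge_atTop R] with r hr
        rw [Real.dist_eq]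
        refine (H r z.1 fun i j => ?_).le
        rw [Set.mem_Icc, ← abs_le]
        have e1 : |z.1 i j| ≤ ∑ j, |z.1 i j| :=
          Finset.single_le_sum (f := fun j => |z.1 i j|) (fun _ _ => abs_nonneg _) (Finset.mem_univ j)
        have e2 : ∑ j, |z.1 i j| ≤ ∑ i, ∑ j, |z.1 i j| :=
          Finset.single_le_sum (f := fun i => ∑ j, |z.1 i j|) (fun _ _ => Finset.sum_nonneg fun _ _ => abs_nonneg _) (Finset.mem_univ i)
        have e3 : (R:ℝ) ≤ r := by exact_mod_cast hr
        linarith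
      have h3 := (sigmoid_cont.tendsto _).comp ht
      rw [sigmoid_logit _ (h0 _) (h1 _)] at h3
      exact (h3.sub_const _).pow 2
  exact ge_of_tendsto' hlim fun r => hm _ _ _ _

end approx

/-- **Theorem 2.** Let `f` be a generator function admitting parameters making the
first-layer convolution map injective, and let `L` be a countable class of loss
functions of common CNNs with a fixed architecture. With probability at least `1 - δ`
over an i.i.d. sample `S` of size `N` from `D`, for every common CNN `F` in the class
and every `ε > 0`, some well-defined GO-CNN `G` with generator `f` and first
fully-connected layer of width `d₁ ≥ d*` satisfies
`E_D[ℓ_G] ≤ Ê_S[F] + 2 Ř_S(L) + √(log(1/δ)/(2N)) + ε`. -/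
theorem goCNN_generalization_bound
    (p : ℕ) (hp : 3 ≤ p)
    (D : Measure (Matrix (Fin p) (Fin p) ℝ × Bool)) [IsProbabilityMeasure D]
    (N : ℕ) (hN : 1 ≤ N)
    (n : ℕ) (f : (Fin n → ℝ) → Matrix (Fin 3) (Fin 3) ℝ)
    (hf : ∃ (od : ℕ) (prm : Fin od → Fin n → ℝ),
      Function.Injective (fun x : Matrix (Fin p) (Fin p) ℝ =>
        fun t : Fin od => conv2d p p 3 hp hp (f (prm t)) x))
    -- fixed architecture of the common CNNs
    (d₀F d₁F : ℕ)
    -- the countable class `L` of loss functions of common CNNs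
    (L : Set ((Matrix (Fin p) (Fin p) ℝ × Bool) → ℝ))
    (hLne : L.Nonempty) (hLct : L.Countable)
    (hLcnn : ∀ ℓ ∈ L,
      ∃ (kerF : Fin d₀F → Matrix (Fin 3) (Fin 3) ℝ)
        (b₀F : Fin d₀F × Fin (p - 3 + 1) × Fin (p - 3 + 1) → ℝ)
        (A₁F : Matrix (Fin d₁F) (Fin d₀F × Fin (p - 3 + 1) × Fin (p - 3 + 1)) ℝ)
        (b₁F a₂F : Fin d₁F → ℝ) (b₂F : ℝ),
        ℓ = cnnLoss hp kerF b₀F A₁F b₁F a₂F b₂F)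
    (δ : ℝ) (hδ : δ ∈ Set.Ioo (0 : ℝ) 1) :
    ENNReal.ofReal (1 - δ) ≤
      (Measure.pi fun _ : Fin N => D)
        {S : Fin N → Matrix (Fin p) (Fin p) ℝ × Bool |
          ∀ ℓF ∈ L, ∀ ε : ℝ, 0 < ε →
            ∃ (dstar d₁ : ℕ), dstar ≤ d₁ ∧
              ∃ (od : ℕ) (prm : Fin od → Fin n → ℝ)
                (b₀G : Fin od × Fin (p - 3 + 1) × Fin (p - 3 + 1) → ℝ)
                (A₁G : Matrix (Fin d₁) (Fin od × Fin (p - 3 + 1) × Fin (p - 3 + 1)) ℝ)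
                (b₁G a₂G : Fin d₁ → ℝ) (b₂G : ℝ),
                -- `G` is well defined
                (∀ x : Matrix (Fin p) (Fin p) ℝ,
                  (∀ t : Fin od, conv2d p p 3 hp hp (f (prm t)) x = 0) → x = 0) ∧
                -- `E_D[ℓ_G] ≤ Ê_S[F] + 2 Ř_S(L) + √(log(1/δ)/(2N)) + ε`
                ∫ z, cnnLoss hp (fun t => f (prm t)) b₀G A₁G b₁G a₂G b₂G z ∂D ≤
                  (N : ℝ)⁻¹ * ∑ i : Fin N, ℓF (S i) + 2 * empRad S L +
                    Real.sqrt (Real.log (1 / δ) / (2 * N)) + ε} := by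
  obtain ⟨od, prm, hinj⟩ := hf
  set ker : Fin od → Matrix (Fin 3) (Fin 3) ℝ := fun t => f (prm t) with hker
  obtain ⟨hδ0, hδ1⟩ := hδ
  have hNp : (0:ℝ) < N := by exact_mod_cast hN
  set t : ℝ := Real.sqrt (Real.log (1 / δ) / (2 * N)) with ht
  have hlog : 0 < Real.log (1 / δ) := Real.log_pos (by rw [lt_div_iff₀ hδ0]; linarith)
  have ht0 : 0 < t := Real.sqrt_pos.2 (by positivity)
  have ht2 : t ^ 2 = Real.log (1 / δ) / (2 * N) := Real.sq_sqrt (by positivity)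
  have hexp : Real.exp (-2 * N * t ^ 2) = δ := by
    rw [ht2, show -2 * (N:ℝ) * (Real.log (1 / δ) / (2 * N)) = - Real.log (1/δ) by field_simp,
      one_div, Real.log_inv, neg_neg, Real.exp_log hδ0]
  obtain ⟨ℓ, rfl⟩ := hLct.exists_eq_range hLne
  have hnet := fun j => hLcnn (ℓ j) ⟨j, rfl⟩
  choose kerF b₀F A₁F b₁F a₂F b₂F hℓ using hnet
  have h0 : ∀ j z, 0 ≤ ℓ j z := fun j z => by rw [hℓ j]; exact (loss_mem hp _ _ _ _ _ _ z).1
  have h1 : ∀ j z, ℓ j z ≤ 1 := fun j z => by rw [hℓ j]; exact (loss_mem hp _ _ _ _ _ _ z).2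
  have hmeas : ∀ j, Measurable (ℓ j) := fun j => by rw [hℓ j]; exact loss_meas hp _ _ _ _ _ _
  let M : Set ℝ := {v | ∃ (d : ℕ) (A : Matrix (Fin d) (Fin od × Fin (p - 3 + 1) × Fin (p - 3 + 1)) ℝ)
    (b a : Fin d → ℝ), v = ∫ z, cnnLoss hp ker 0 A b a 0 z ∂D}
  have hMb : BddBelow M := ⟨0, by
    rintro _ ⟨d, A, b, a, rfl⟩
    exact integral_nonneg fun z => (loss_mem hp _ _ _ _ _ _ z).1⟩
  have hMne : M.Nonempty := ⟨_, 0, 0, 0, 0, rfl⟩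
  set m : ℝ := sInf M with hmdef
  have hm : ∀ (d : ℕ) (A : Matrix (Fin d) (Fin od × Fin (p - 3 + 1) × Fin (p - 3 + 1)) ℝ) (b a : Fin d → ℝ),
      m ≤ ∫ z, cnnLoss hp ker 0 A b a 0 z ∂D := fun d A b a => csInf_le hMb ⟨d, A, b, a, rfl⟩
  have hP2 := fun h hh k0 k1 => inf_le hp D ker hinj h hh k0 k1 m hm
  have hm4 : m ≤ 1/4 := by
    have := hP2 (fun _ => 1/2) continuous_const (fun _ => by norm_num) (fun _ => by norm_num)
    refine this.trans (le_of_eq ?_)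
    have e : ∀ z : Matrix (Fin p) (Fin p) ℝ × Bool, ((1/2:ℝ) - (if z.2 then (1:ℝ) else 0))^2 = 1/4 := by
      rintro ⟨x, y⟩
      cases y <;> norm_num
    simp_rw [e]
    simp
  set ν := Measure.pi fun _ : Fin N => D
  have hbad : ν {S | ∃ j, (N:ℝ)⁻¹ * ∑ i, ℓ j (S i) + 2 * empRad S (Set.range ℓ) + t < m} ≤ ENNReal.ofReal δ := by
    rcases le_or_gt t (1/4) with h4 | h4
    · rw [← hexp]
      refine core_bound D hN ℓ h0 h1 hmeas m t ht0 fun j => ?_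
      have hmg := mgf_bound D (fun z : Matrix (Fin p) (Fin p) ℝ × Bool =>
          sigmoid (cnnOut hp (kerF j) (b₀F j) (A₁F j) (b₁F j) (a₂F j) (b₂F j) z.1)) (fun z => z.2)
        (sigmoid_cont.measurable.comp ((out_meas hp _ _ _ _ _ _).comp measurable_fst)) measurable_snd
        (fun z => (sigmoid_mem _).1.le) (fun z => (sigmoid_mem _).2.le) (4*t) m (by linarith) (by linarith)
        (hP2 (fun x => polyW (4*t) (sigmoid (cnnOut hp (kerF j) (b₀F j) (A₁F j) (b₁F j) (a₂F j) (b₂F j) x)))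
          (by
            have hw : Continuous (polyW (4*t)) := by unfold polyW; fun_prop
            exact hw.comp (sigmoid_cont.comp (out_cont hp _ _ _ _ _ _)))
          (fun x => (polyW_mem _ _ (by linarith) (by linarith) (sigmoid_mem _).1.le (sigmoid_mem _).2.le).1)
          (fun x => (polyW_mem _ _ (by linarith) (by linarith) (sigmoid_mem _).1.le (sigmoid_mem _).2.le).2))
      rw [show 2 * (4*t) = 8*t by ring, show (4*t)^2/4 - 8*t*m = 4*t^2 - 8*t*m by ring] at hmg
      rw [hℓ j]
      exact hmg
    · have : {S : Fin N → Matrix (Fin p) (Fin p) ℝ × Bool | ∃ j, (N:ℝ)⁻¹ * ∑ i, ℓ j (S i) + 2 * empRad S (Set.range ℓ) + t < m} = ∅ := by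
        rw [Set.eq_empty_iff_forall_notMem]
        rintro S ⟨j, hj⟩
        have := emp_nonneg hN ℓ h0 h1 S j
        linarith
      rw [this, measure_empty]
      exact zero_le
  set good : Set (Fin N → Matrix (Fin p) (Fin p) ℝ × Bool) := _
  change ENNReal.ofReal (1 - δ) ≤ ν good
  have hcov : (Set.univ : Set (Fin N → Matrix (Fin p) (Fin p) ℝ × Bool)) ⊆
      good ∪ {S | ∃ j, (N:ℝ)⁻¹ * ∑ i, ℓ j (S i) + 2 * empRad S (Set.range ℓ) + t < m} := by
    intro S _
    by_cases hS : ∃ j, (N:ℝ)⁻¹ * ∑ i, ℓ j (S i) + 2 * empRad S (Set.range ℓ) + t < m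
    · exact Or.inr hS
    · left
      push Not at hS
      rintro _ ⟨j, rfl⟩ ε hε
      obtain ⟨_, ⟨d, A, b, a, rfl⟩, hv⟩ := exists_lt_of_csInf_lt hMne (show sInf M < m + ε by linarith)
      refine ⟨0, d, Nat.zero_le _, od, prm, 0, A, b, a, 0, fun x hx => ?_, ?_⟩
      · apply hinj
        funext t
        dsimp only
        rw [hx t]
        funext i j
        simp [conv2d]
      · have := hS j
        exact hv.le.trans (by linarith)
  have h1le : (1 : ENNReal) ≤ ν good + ENNReal.ofReal δ := by
    calc (1 : ENNReal) = ν Set.univ := measure_univ.symm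
      _ ≤ _ := measure_mono hcov
      _ ≤ _ := measure_union_le _ _
      _ ≤ _ := by gcongr
  rw [ENNReal.ofReal_sub _ hδ0.le, ENNReal.ofReal_one]
  exact tsub_le_iff_right.2 h1le
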